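/- Example 6.2, verification of condition (4.Qassmp). In the setting of the chain on ℤ₊ with p_n = (n+1)^{−s}, q_n = (n/(n+1))^t, s > 0, t > 0, 1/2 < t − s < 1: for every c > 0 and every 0 < ε < t there exist c″ > 0 and K > 1 such that for all r ≥ 1, sup_{n ≥ Kr} P_n[ T/n^{s+1} ≤ c r^{−s−1+ε} ] ≤ c″ r^{−s−1+ε}. In particular, since ζ = s − t, the chain with partition E_n = {n} and ψ(n) = n^{s+1} satisfies condition (4.Qassmp): there exist ε′ > 0, c > 0, N > 1, k > 0, ε₀ > 0 with sup_{n≥Nr} P_n[T/ψ(n) ≤ c r^{−(s+1)+ε′}] < k r^{−ζ−1−ε₀} for every r ≥ 1. -/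

import Mathlib

open MeasureTheory ProbabilityTheory Filter Set Topology
open scoped ENNReal NNReal

noncomputable section

/-- `p_n = (n+1)^{-s}` (with `p_0 = 1`). -/
def pcoef (s : ℝ) (n : ℕ) : ℝ := ((n : ℝ) + 1) ^ (-s)

/-- `q_n = (n/(n+1))^t` for `n ≥ 1`, with `q_0 = 1`. -/
def qcoef (t : ℝ) (n : ℕ) : ℝ := if n = 0 then 1 else ((n : ℝ) / ((n : ℝ) + 1)) ^ t

/-- The transition matrix of Example 6.2: from `0` jump to `1`; from `i ≠ 0` go to `i+1`
with probability `p_i q_i`, to `0` with probability `p_i (1-q_i)`, stay with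
probability `1 - p_i`. -/
def Pmat (s t : ℝ) (i j : ℕ) : ℝ :=
  if i = 0 then (if j = 1 then 1 else 0)
  else (if j = i + 1 then pcoef s i * qcoef t i else 0)
    + (if j = 0 then pcoef s i * (1 - qcoef t i) else 0)
    + (if j = i then 1 - pcoef s i else 0)

/-- First hitting time (after time `0`) of the set `a`, `⊤` if the set is never hit. -/
def hitT {E : Type*} (a : Set E) (ω : ℕ → E) : ℕ∞ :=
  ⨅ (n : ℕ) (_ : 0 < n ∧ ω n ∈ a), (n : ℕ∞)

/-- Coercion `ℕ∞ → ℝ≥0∞`. -/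
def ennOf (e : ℕ∞) : ℝ≥0∞ := WithTop.map (Nat.cast : ℕ → ℝ≥0) e

lemma pcoef_nonneg (s : ℝ) (n : ℕ) : 0 ≤ pcoef s n := by
  unfold pcoef; positivity

lemma pcoef_le_one {s : ℝ} (hs : 0 ≤ s) (n : ℕ) : pcoef s n ≤ 1 :=
  Real.rpow_le_one_of_one_le_of_nonpos (by linarith [n.cast_nonneg (α := ℝ)]) (by linarith)

lemma qcoef_nonneg (t : ℝ) (n : ℕ) : 0 ≤ qcoef t n := by
  unfold qcoef; split_ifs <;> positivity

lemma qcoef_le_one {t : ℝ} (ht : 0 ≤ t) (n : ℕ) : qcoef t n ≤ 1 := by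
  unfold qcoef
  split_ifs
  · exact le_rfl
  · exact Real.rpow_le_one (by positivity) ((div_le_one (by positivity)).2 (by linarith)) ht

lemma one_sub_qcoef_le {t : ℝ} (n : ℕ) : 1 - qcoef t n ≤ max 1 t / ((n : ℝ) + 1) := by
  have hn : (0 : ℝ) < (n : ℝ) + 1 := by positivity
  unfold qcoef
  split_ifs with h
  · rw [sub_self]; positivity
  have hx : (n : ℝ) / (n + 1) = 1 + -(1 / ((n : ℝ) + 1)) := by field_simp; ring
  have hx1 : (n : ℝ) / (n + 1) ≤ 1 := (div_le_one hn).2 (by linarith)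
  have hx0 : (0 : ℝ) < (n : ℝ) / (n + 1) := by
    have : (0 : ℝ) < n := by exact_mod_cast Nat.pos_of_ne_zero h
    positivity
  rcases le_total 1 t with ht | ht
  · rw [max_eq_right ht]
    have := one_add_mul_self_le_rpow_one_add (s := -(1 / ((n : ℝ) + 1))) (by linarith) ht
    rw [← hx] at this
    have e : t / ((n : ℝ) + 1) = t * (1 / ((n : ℝ) + 1)) := by ring
    linarith
  · rw [max_eq_left ht]
    have := Real.rpow_le_rpow_of_exponent_ge hx0 hx1 ht
    rw [Real.rpow_one] at this
    linarith

lemma Pmat_nonneg {s t : ℝ} (hs : 0 ≤ s) (ht : 0 ≤ t) (i j : ℕ) : 0 ≤ Pmat s t i j := by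
  have h1 := pcoef_nonneg s i
  have h2 := pcoef_le_one hs i
  have h3 := qcoef_nonneg t i
  have h4 := qcoef_le_one ht i
  have h5 : 0 ≤ pcoef s i * qcoef t i := mul_nonneg h1 h3
  have h6 : 0 ≤ pcoef s i * (1 - qcoef t i) := mul_nonneg h1 (by linarith)
  unfold Pmat
  split_ifs <;> linarith

/-- Away from the jumps to `0`, the chain never moves down. -/
lemma le_of_Pmat_ne_zero {s t : ℝ} {i j : ℕ} (hj : j ≠ 0) (h : Pmat s t i j ≠ 0) : i ≤ j := by
  by_contra! hlt
  apply h
  unfold Pmat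
  rw [if_neg (by omega), if_neg (by omega), if_neg hj, if_neg (by omega)]
  norm_num

/-- From any state above `n`, the probability of jumping to `0` is `O(n ^ (-s-1))`. -/
lemma Pmat_zero_le {s t : ℝ} (hs : 0 ≤ s) {n i : ℕ} (hn : n ≠ 0) (hi : n ≤ i) :
    Pmat s t i 0 ≤ max 1 t * ((n : ℝ) + 1) ^ (-(s + 1)) := by
  have hi0 : i ≠ 0 := by omega
  have hpos : (0 : ℝ) < (i : ℝ) + 1 := by positivity
  have e : Pmat s t i 0 = pcoef s i * (1 - qcoef t i) := by
    unfold Pmat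
    rw [if_neg hi0, if_neg (by omega), if_pos rfl, if_neg (by omega)]
    ring
  calc Pmat s t i 0 = pcoef s i * (1 - qcoef t i) := e
    _ ≤ pcoef s i * (max 1 t / ((i : ℝ) + 1)) :=
        mul_le_mul_of_nonneg_left (one_sub_qcoef_le i) (pcoef_nonneg s i)
    _ = max 1 t * ((i : ℝ) + 1) ^ (-(s + 1)) := by
        rw [pcoef, neg_add, ← sub_eq_add_neg, Real.rpow_sub_one hpos.ne']; ring
    _ ≤ max 1 t * ((n : ℝ) + 1) ^ (-(s + 1)) := by
        refine mul_le_mul_of_nonneg_left ?_ (by positivity)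
        refine Real.rpow_le_rpow_of_nonpos (by positivity) ?_ (by linarith)
        have : (n : ℝ) ≤ i := by exact_mod_cast hi
        linarith

/-- A path of positive weight that avoids `0` stays above its starting point. -/
lemma le_of_prod_Pmat_ne_zero {s t : ℝ} {x k : ℕ} {j : ℕ → ℕ} (hj : ∀ i ≤ k, j i ≠ 0)
    (h : ∏ i ∈ Finset.range (k + 1), Pmat s t (if i = 0 then x else j (i - 1)) (j i) ≠ 0) :
    x ≤ j k := by
  rw [Finset.prod_ne_zero_iff] at h
  have key : ∀ i ≤ k, x ≤ j i := by
    intro i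
    induction i with
    | zero => intro hi; exact le_of_Pmat_ne_zero (hj 0 hi) (by simpa using h 0 (by simp))
    | succ i ih =>
      intro hi
      refine (ih (by omega)).trans (le_of_Pmat_ne_zero (s := s) (t := t) (hj _ hi) ?_)
      simpa using h (i + 1) (by simp; omega)
  exact key k le_rfl

/-- The probability that the chain started at `n` first returns to `0` at a given time is
bounded by the largest jump rate to `0` above `n`. -/
lemma measure_first_hit_le {s t : ℝ} (hs : 0 ≤ s) (ht : 0 ≤ t) {n : ℕ} (hn : n ≠ 0)
    (μ : Measure (ℕ → ℕ)) [IsProbabilityMeasure μ]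
    (hmarkov : ∀ (k : ℕ) (j : ℕ → ℕ),
      μ {ω | ∀ i ≤ k, ω (i + 1) = j i}
        = ENNReal.ofReal (∏ i ∈ Finset.range (k + 1),
            Pmat s t (if i = 0 then n else j (i - 1)) (j i))) (k : ℕ) :
    μ {ω | ω (k + 1) = 0 ∧ ∀ i < k, ω (i + 1) ≠ 0}
      ≤ ENNReal.ofReal (max 1 t * ((n : ℝ) + 1) ^ (-(s + 1))) := by
  cases k with
  | zero =>
    have h := hmarkov 0 (fun _ => 0)
    simp only [Nat.le_zero, forall_eq, zero_add, Finset.range_one, Finset.prod_singleton,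
      if_true] at h
    simp only [zero_add, Nat.not_lt_zero, false_imp_iff, implies_true, and_true]
    rw [h]
    exact ENNReal.ofReal_le_ofReal (Pmat_zero_le hs hn le_rfl)
  | succ k =>
    set H := max 1 t * ((n : ℝ) + 1) ^ (-(s + 1))
    let ext : (Fin (k + 1) → ℕ) → ℕ → ℕ := fun f i => if h : i < k + 1 then f ⟨i, h⟩ else 0
    have hext : ∀ f (i : Fin (k + 1)), ext f i = f i := fun f i => dif_pos i.2
    let cyl : (Fin (k + 1) → ℕ) → Set (ℕ → ℕ) := fun f => {ω | ∀ i ≤ k, ω (i + 1) = ext f i}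
    let S : Set (Fin (k + 1) → ℕ) := {f | ∀ i, f i ≠ 0}
    have hcover : {ω : ℕ → ℕ | ω (k + 1 + 1) = 0 ∧ ∀ i < k + 1, ω (i + 1) ≠ 0} ⊆
        ⋃ f : S, {ω | ∀ i ≤ k + 1, ω (i + 1) = ext f i} := by
      rintro ω ⟨h0, h1⟩
      refine mem_iUnion.2 ⟨⟨fun i => ω (i + 1), fun i => h1 i i.2⟩, fun i hi => ?_⟩
      by_cases h : i < k + 1
      · exact (hext (fun i => ω (i + 1)) ⟨i, h⟩).symm
      · obtain rfl : i = k + 1 := by omega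
        simpa [ext] using h0
    have hterm : ∀ f : S, μ {ω | ∀ i ≤ k + 1, ω (i + 1) = ext f i}
        ≤ μ (cyl f) * ENNReal.ofReal H := by
      intro f
      have hprod0 : 0 ≤ ∏ i ∈ Finset.range (k + 1),
          Pmat s t (if i = 0 then n else ext f (i - 1)) (ext f i) :=
        Finset.prod_nonneg fun i _ => Pmat_nonneg hs ht _ _
      have hlast : ext f (k + 1) = 0 := by simp [ext]
      rw [hmarkov, hmarkov k, Finset.prod_range_succ, ← ENNReal.ofReal_mul hprod0]
      refine ENNReal.ofReal_le_ofReal ?_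
      rcases eq_or_ne (∏ i ∈ Finset.range (k + 1),
          Pmat s t (if i = 0 then n else ext f (i - 1)) (ext f i)) 0 with hz | hz
      · rw [hz, zero_mul, zero_mul]
      · refine mul_le_mul_of_nonneg_left ?_ hprod0
        have hge : n ≤ ext f k := by
          refine le_of_prod_Pmat_ne_zero (fun i hi => ?_) hz
          exact (hext f ⟨i, by omega⟩).trans_ne (f.2 _)
        rw [hlast, if_neg k.succ_ne_zero, Nat.add_sub_cancel]
        exact Pmat_zero_le hs hn hge
    have hmeas : ∀ f, MeasurableSet (cyl f) := by
      intro f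
      have : cyl f = ⋂ i, ⋂ (_ : i ≤ k), (fun ω : ℕ → ℕ => ω (i + 1)) ⁻¹' {ext f i} := by
        ext ω; simp [cyl]
      rw [this]
      exact MeasurableSet.iInter fun i => MeasurableSet.iInter fun _ =>
        measurable_pi_apply (i + 1) (measurableSet_singleton _)
    have hdisj : Pairwise (Function.onFun Disjoint fun f : S => cyl f) := by
      intro f g hfg
      refine Set.disjoint_left.2 fun ω hf hg => hfg (Subtype.ext (funext fun i => ?_))
      have h := (hf i (by omega)).symm.trans (hg i (by omega))
      rwa [hext, hext] at h
    calc μ {ω | ω (k + 1 + 1) = 0 ∧ ∀ i < k + 1, ω (i + 1) ≠ 0}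
        ≤ μ (⋃ f : S, {ω | ∀ i ≤ k + 1, ω (i + 1) = ext f i}) := measure_mono hcover
      _ ≤ ∑' f : S, μ {ω | ∀ i ≤ k + 1, ω (i + 1) = ext f i} := measure_iUnion_le _
      _ ≤ ∑' f : S, μ (cyl f) * ENNReal.ofReal H := ENNReal.tsum_le_tsum hterm
      _ = μ (⋃ f : S, cyl f) * ENNReal.ofReal H := by
          rw [ENNReal.tsum_mul_right, measure_iUnion hdisj fun f => hmeas f]
      _ ≤ 1 * ENNReal.ofReal H := by gcongr; exact prob_le_one
      _ = ENNReal.ofReal H := one_mul _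

/-- Union bound for the return time to `0` of the chain started at `n`. -/
lemma measure_hit_le {s t : ℝ} (hs : 0 ≤ s) (ht : 0 ≤ t) {n : ℕ} (hn : n ≠ 0)
    (μ : Measure (ℕ → ℕ)) [IsProbabilityMeasure μ]
    (hmarkov : ∀ (k : ℕ) (j : ℕ → ℕ),
      μ {ω | ∀ i ≤ k, ω (i + 1) = j i}
        = ENNReal.ofReal (∏ i ∈ Finset.range (k + 1),
            Pmat s t (if i = 0 then n else j (i - 1)) (j i))) {a : ℝ} (ha : 0 ≤ a) :
    (μ {ω | ∃ m : ℕ, 0 < m ∧ (m : ℝ) ≤ a * (n : ℝ) ^ (s + 1) ∧ ω m = 0}).toReal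
      ≤ a * max 1 t := by
  set H := max 1 t * ((n : ℝ) + 1) ^ (-(s + 1))
  have hH : 0 ≤ H := by positivity
  set M := a * (n : ℝ) ^ (s + 1)
  have hM : 0 ≤ M := by positivity
  have hcover : {ω : ℕ → ℕ | ∃ m : ℕ, 0 < m ∧ (m : ℝ) ≤ M ∧ ω m = 0} ⊆
      ⋃ k ∈ Finset.range ⌊M⌋₊, {ω | ω (k + 1) = 0 ∧ ∀ i < k, ω (i + 1) ≠ 0} := by
    rintro ω ⟨m, hm, hmM, h0⟩
    obtain ⟨m, rfl⟩ := Nat.exists_eq_succ_of_ne_zero hm.ne'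
    have hex : ∃ k, ω (k + 1) = 0 := ⟨m, h0⟩
    refine mem_iUnion₂.2 ⟨Nat.find hex, ?_, Nat.find_spec hex, fun i hi => Nat.find_min hex hi⟩
    have h1 : Nat.find hex ≤ m := Nat.find_min' hex h0
    have h2 : m + 1 ≤ ⌊M⌋₊ := Nat.le_floor hmM
    exact Finset.mem_range.2 (by omega)
  have hbound : μ {ω | ∃ m : ℕ, 0 < m ∧ (m : ℝ) ≤ M ∧ ω m = 0} ≤ ENNReal.ofReal (⌊M⌋₊ * H) :=
    calc _ ≤ ∑ k ∈ Finset.range ⌊M⌋₊, μ {ω | ω (k + 1) = 0 ∧ ∀ i < k, ω (i + 1) ≠ 0} :=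
          (measure_mono hcover).trans (measure_biUnion_finset_le _ _)
      _ ≤ ∑ k ∈ Finset.range ⌊M⌋₊, ENNReal.ofReal H :=
          Finset.sum_le_sum fun k _ => measure_first_hit_le hs ht hn μ hmarkov k
      _ = ENNReal.ofReal (⌊M⌋₊ * H) := by
          rw [Finset.sum_const, Finset.card_range, nsmul_eq_mul,
            ENNReal.ofReal_mul (Nat.cast_nonneg _), ENNReal.ofReal_natCast]
  have hratio : (n : ℝ) ^ (s + 1) * ((n : ℝ) + 1) ^ (-(s + 1)) ≤ 1 := by
    rw [Real.rpow_neg (by positivity), ← div_eq_mul_inv]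
    refine (div_le_one (by positivity)).2 ?_
    exact Real.rpow_le_rpow (by positivity) (by linarith) (by linarith)
  calc _ ≤ ⌊M⌋₊ * H := ENNReal.toReal_le_of_le_ofReal (by positivity) hbound
    _ ≤ M * H := mul_le_mul_of_nonneg_right (Nat.floor_le hM) hH
    _ = a * max 1 t * ((n : ℝ) ^ (s + 1) * ((n : ℝ) + 1) ^ (-(s + 1))) := by ring
    _ ≤ a * max 1 t * 1 := mul_le_mul_of_nonneg_left hratio (by positivity)
    _ = a * max 1 t := mul_one _

/-- **Example 6.2: verification of condition (eq:Qassmp).** -/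
theorem example62_Qassmp
    (s t : ℝ) (hs : 0 < s) (ht : 0 < t) (hts1 : 1 / 2 < t - s) (hts2 : t - s < 1)
    /- the laws `P_x` of the chain started at `x` -/
    (Pm : ℕ → Measure (ℕ → ℕ)) (hPmProb : ∀ x, IsProbabilityMeasure (Pm x))
    (hstart : ∀ x, Pm x {ω | ω 0 = x} = 1)
    (hmarkov : ∀ (x k : ℕ) (j : ℕ → ℕ),
      Pm x {ω | ∀ i ≤ k, ω (i + 1) = j i}
        = ENNReal.ofReal (∏ i ∈ Finset.range (k + 1),
            Pmat s t (if i = 0 then x else j (i - 1)) (j i))) :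
    /- for every `c > 0` and `0 < ε < t` there are `c'' > 0`, `K > 1` with
    `sup_{n ≥ Kr} P_n[T/n^{s+1} ≤ c r^{-s-1+ε}] ≤ c'' r^{-s-1+ε}` for all `r ≥ 1` -/
    (∀ c : ℝ, 0 < c → ∀ ε : ℝ, 0 < ε → ε < t →
      ∃ c'' > (0:ℝ), ∃ K : ℝ, 1 < K ∧ ∀ r : ℝ, 1 ≤ r → ∀ n : ℕ, K * r ≤ (n : ℝ) →
        (Pm n {ω | ∃ m : ℕ, 0 < m ∧
            (m : ℝ) ≤ c * r ^ (-s - 1 + ε) * (n : ℝ) ^ (s + 1) ∧ ω m = 0}).toReal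
          ≤ c'' * r ^ (-s - 1 + ε)) ∧
    /- in particular condition (eq:Qassmp) holds with `ψ(n) = n^{s+1}`, `β = s+1`,
    `ζ = s - t` -/
    (∃ ε' > (0:ℝ), ∃ c > (0:ℝ), ∃ N : ℝ, 1 < N ∧ ∃ k > (0:ℝ), ∃ ε₀ > (0:ℝ),
      ∀ r : ℝ, 1 ≤ r → ∀ n : ℕ, N * r ≤ (n : ℝ) →
        (Pm n {ω | ∃ m : ℕ, 0 < m ∧
            (m : ℝ) ≤ c * r ^ (-(s + 1) + ε') * (n : ℝ) ^ (s + 1) ∧ ω m = 0}).toReal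
          < k * r ^ (-(s - t) - 1 - ε₀)) := by
  have key : ∀ c : ℝ, 0 < c → ∀ e r : ℝ, 1 ≤ r → ∀ n : ℕ, 2 * r ≤ (n : ℝ) →
      (Pm n {ω | ∃ m : ℕ, 0 < m ∧
        (m : ℝ) ≤ c * r ^ e * (n : ℝ) ^ (s + 1) ∧ ω m = 0}).toReal
          ≤ c * max 1 t * r ^ e := by
    intro c hc e r hr n hrn
    have hn : n ≠ 0 := by rintro rfl; norm_num at hrn; linarith
    have := hPmProb n
    refine (measure_hit_le hs.le ht.le hn (Pm n) (hmarkov n)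
      (a := c * r ^ e) (by positivity)).trans_eq (by ring)
  refine ⟨fun c hc ε _ _ => ⟨c * max 1 t, by positivity, 2, one_lt_two, key c hc _⟩, ?_⟩
  refine ⟨t / 2, by positivity, 1, one_pos, 2, one_lt_two, 1 * max 1 t + 1, by positivity,
    t / 2, by positivity, fun r hr n hn => (key 1 one_pos _ r hr n hn).trans_lt ?_⟩
  rw [show -(s - t) - 1 - t / 2 = -(s + 1) + t / 2 by ring]
  exact mul_lt_mul_of_pos_right (lt_add_one _) (by positivity)
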